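/- arXiv:1907.00513 — 3 statements merged into one kernel-verified Lean document; each statement's English description precedes it below -/
import Mathlib

section
/- Let G be a finite group, p a prime, and h a positive integer with hp dividing |G|. Let ψ_K(n) denote the number of subgroups of order n in a group K. Then ψ_G(h) ≡ Σ_{K ≤ G, |K| = hp} ψ_K(h) (mod p). -/
open scoped Classical

noncomputable instance subgroupFintype (G : Type*) [Group G] [Finite G] :
    Fintype (Subgroup G) := Fintype.ofFinite _

/-- Subsets of `G`, with `G` acting by right translation. -/
def PS (G : Type*) := Set G

noncomputable instance psFintype (G : Type*) [Finite G] : Fintype (PS G) :=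
  haveI : Finite (PS G) := inferInstanceAs (Finite (Set G))
  Fintype.ofFinite _

/-- cardinality of a subset -/
noncomputable def PS.size {G : Type*} (X : PS G) : ℕ := Set.ncard (show Set G from X)

instance psAction (G : Type*) [Group G] : MulAction G (PS G) where
  smul g X := (fun x : G => x * g) ⁻¹' (show Set G from X)
  one_smul X := by
    change (fun x : G => x * 1) ⁻¹' (show Set G from X) = (show Set G from X)
    ext x
    rw [Set.mem_preimage, mul_one]
  mul_smul g k X := by
    change (fun x : G => x * (g * k)) ⁻¹' (show Set G from X) =
      (fun x : G => x * g) ⁻¹' ((fun x : G => x * k) ⁻¹' (show Set G from X))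
    ext x
    rw [Set.mem_preimage, Set.mem_preimage, Set.mem_preimage, mul_assoc]

theorem ps_smul_def {G : Type*} [Group G] (g : G) (X : PS G) :
    g • X = ((fun x : G => x * g) ⁻¹' (show Set G from X) : Set G) := rfl

theorem ps_size_smul {G : Type*} [Group G] (g : G) (X : PS G) : (g • X).size = X.size := by
  unfold PS.size
  rw [ps_smul_def]
  exact Set.ncard_preimage_of_injective_subset_range (mul_left_injective g)
    (fun x _ => ⟨x * g⁻¹, by simp⟩)

theorem ps_le_stab_iff {G : Type*} [Group G] (H : Subgroup G) (X : PS G) :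
    H ≤ MulAction.stabilizer G X ↔
      ∃ Y : Set (G ⧸ H), X = ((QuotientGroup.mk : G → G ⧸ H) ⁻¹' Y : Set G) := by
  constructor
  · intro hX
    refine ⟨(QuotientGroup.mk : G → G ⧸ H) '' (show Set G from X), ?_⟩
    apply Set.Subset.antisymm
    · exact Set.subset_preimage_image _ _
    · rintro x ⟨y, hy, hxy⟩
      have h1 : y⁻¹ * x ∈ H := QuotientGroup.eq.mp hxy
      have h2 := hX (H.inv_mem h1)
      rw [MulAction.mem_stabilizer_iff, ps_smul_def] at h2
      have h3 : x ∈ (fun z : G => z * (y⁻¹ * x)⁻¹) ⁻¹' (show Set G from X) := by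
        rw [Set.mem_preimage]
        have h4 : x * (y⁻¹ * x)⁻¹ = y := by group
        rw [h4]
        exact hy
      exact (Set.ext_iff.mp h2 x).mp h3
  · rintro ⟨Y, rfl⟩ g hg
    refine MulAction.mem_stabilizer_iff.mpr ?_
    change (fun x : G => x * g) ⁻¹' ((QuotientGroup.mk : G → G ⧸ H) ⁻¹' Y) =
      (QuotientGroup.mk : G → G ⧸ H) ⁻¹' Y
    ext x
    have : ((x * g : G) : G ⧸ H) = (x : G ⧸ H) := by
      rw [QuotientGroup.eq]; simpa using hg
    rw [Set.mem_preimage, Set.mem_preimage, Set.mem_preimage, this]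

theorem ps_size_preimage {G : Type*} [Group G] (H : Subgroup G) (Y : Set (G ⧸ H)) :
    PS.size (G := G) ((QuotientGroup.mk : G → G ⧸ H) ⁻¹' Y : Set G) = Nat.card H * Y.ncard := by
  unfold PS.size
  change Set.ncard ((QuotientGroup.mk : G → G ⧸ H) ⁻¹' Y) = _
  rw [← Nat.card_coe_set_eq, Nat.card_congr (QuotientGroup.preimageMkEquivSubgroupProdSet H Y),
    Nat.card_prod, Nat.card_coe_set_eq]

theorem ps_stab_dvd {G : Type*} [Group G] (X : PS G) :
    Nat.card (MulAction.stabilizer G X) ∣ X.size := by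
  obtain ⟨Y, hY⟩ := (ps_le_stab_iff (MulAction.stabilizer G X) X).mp le_rfl
  have := ps_size_preimage _ Y
  rw [← hY] at this
  exact ⟨_, this⟩

theorem card_sets_ncard (α : Type*) [Finite α] (q : ℕ) :
    Nat.card {Y : Set α // Y.ncard = q} = (Nat.card α).choose q := by
  have := Fintype.ofFinite α
  rw [← Set.powersetCard.card]
  symm
  refine Nat.card_congr (Equiv.ofBijective
    (fun s => ⟨((s : Finset α) : Set α), Set.powersetCard.ncard_eq s⟩) ⟨?_, ?_⟩)
  · intro s t hst
    simpa using hst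
  · rintro ⟨Y, hY⟩
    refine ⟨⟨Y.toFinset, ?_⟩, ?_⟩
    · rw [Set.powersetCard.mem_iff, ← hY, Set.ncard_eq_toFinset_card']
    · simp

theorem ps_count {G : Type*} [Group G] [Finite G] (H : Subgroup G) (q : ℕ) :
    Nat.card {X : PS G // H ≤ MulAction.stabilizer G X ∧ X.size = Nat.card H * q} =
      H.index.choose q := by
  rw [Subgroup.index, ← card_sets_ncard]
  symm
  have hpos : 0 < Nat.card H := Nat.card_pos
  refine Nat.card_congr (Equiv.ofBijective
    (fun Y => ⟨((QuotientGroup.mk : G → G ⧸ H) ⁻¹' Y.1 : Set G),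
      (ps_le_stab_iff _ _).mpr ⟨_, rfl⟩, by rw [ps_size_preimage, Y.2]⟩) ⟨?_, ?_⟩)
  · intro Y Z hYZ
    apply Subtype.ext
    exact Set.preimage_injective.mpr QuotientGroup.mk_surjective (Subtype.ext_iff.mp hYZ)
  · rintro ⟨X, hX, hs⟩
    obtain ⟨Y, rfl⟩ := (ps_le_stab_iff _ _).mp hX
    rw [ps_size_preimage] at hs
    exact ⟨⟨Y, Nat.eq_of_mul_eq_mul_left hpos hs⟩, rfl⟩

theorem dvd_card_of_stab {G α : Type*} [Group G] [Finite G] [Finite α] [MulAction G α] (h m : ℕ)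
    (hh : 0 < h) (hG : Nat.card G = h * m)
    (hst : ∀ a : α, Nat.card (MulAction.stabilizer G a) = h) : m ∣ Nat.card α := by
  have := Fintype.ofFinite (Quotient (MulAction.orbitRel G α))
  rw [Nat.card_congr (MulAction.selfEquivSigmaOrbitsQuotientStabilizer G α), Nat.card_sigma]
  apply Finset.dvd_sum
  intro ω _
  have h1 := Subgroup.card_mul_index (MulAction.stabilizer G (Quotient.out ω))
  rw [hst, hG] at h1
  have h2 := Nat.eq_of_mul_eq_mul_left hh h1
  rw [Subgroup.index] at h2
  exact h2.symm ▸ dvd_rfl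

theorem ps_dvd {G : Type*} [Group G] [Finite G] (h m n : ℕ)
    (hh : 0 < h) (hG : Nat.card G = h * m) :
    m ∣ Nat.card {X : PS G // X.size = n ∧ Nat.card (MulAction.stabilizer G X) = h} := by
  let A : SubMulAction G (PS G) :=
    { carrier := {X | X.size = n ∧ Nat.card (MulAction.stabilizer G X) = h}
      smul_mem' := by
        rintro g X ⟨h1, h2⟩
        refine ⟨by rw [ps_size_smul, h1], ?_⟩
        rw [MulAction.stabilizer_smul_eq_stabilizer_map_conj, ← h2]
        exact (Nat.card_congr ((MulAction.stabilizer G X).equivMapOfInjective _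
          (MulAut.conj g).injective).toEquiv).symm }
  change m ∣ Nat.card A
  have : Finite A := Subtype.finite
  refine dvd_card_of_stab (G := G) h m hh hG ?_
  intro a
  rw [SubMulAction.stabilizer_of_subMul]
  exact a.2.2

theorem card_subgroups_le {G : Type*} [Group G] (K : Subgroup G) (h : ℕ) :
    Nat.card {H : Subgroup K // Nat.card H = h} =
      Nat.card {H : Subgroup G // Nat.card H = h ∧ H ≤ K} := by
  refine Nat.card_congr (Equiv.ofBijective
    (fun H => ⟨H.1.map K.subtype, ?_, Subgroup.map_subtype_le _⟩) ⟨?_, ?_⟩)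
  · refine Eq.trans ?_ H.2
    exact (Nat.card_congr (H.1.equivMapOfInjective _ K.subtype_injective).toEquiv).symm
  · intro H H' hH
    exact Subtype.ext (Subgroup.map_injective K.subtype_injective (Subtype.ext_iff.mp hH))
  · rintro ⟨H, hH, hK⟩
    refine ⟨⟨H.subgroupOf K, ?_⟩, Subtype.ext (Subgroup.map_subgroupOf_eq_of_le hK)⟩
    rw [← hH]
    exact Nat.card_congr (Subgroup.subgroupOfEquivOfLe hK).toEquiv

theorem choose_aux (p t : ℕ) (hp : p.Prime) (ht : 0 < t) :
    ∃ c, (p * t).choose p = t * c ∧ c ≡ 1 [MOD p] := by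
  have : Fact p.Prime := ⟨hp⟩
  have hp0 := hp.pos
  refine ⟨(p * t - 1).choose (p - 1), ?_, ?_⟩
  · have h1 := Nat.add_one_mul_choose_eq (p * t - 1) (p - 1)
    have h2 : p * t - 1 + 1 = p * t := Nat.sub_add_cancel (Nat.mul_pos hp0 ht)
    rw [h2, Nat.sub_add_cancel hp0] at h1
    apply Nat.eq_of_mul_eq_mul_left hp0
    rw [← mul_assoc, h1, mul_comm]
  · have h1 := Choose.choose_modEq_choose_mod_mul_choose_div_nat (p := p)
      (n := p * t - 1) (k := p - 1)
    have h2 : (p * t - 1) % p = p - 1 := by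
      obtain ⟨s, rfl⟩ : ∃ s, t = s + 1 := ⟨t - 1, by omega⟩
      have : p * (s + 1) - 1 = (p - 1) + p * s := by rw [mul_add]; omega
      rw [this, Nat.add_mul_mod_self_left, Nat.mod_eq_of_lt (by omega)]
    have h3 : (p - 1) / p = 0 := Nat.div_eq_of_lt (by omega)
    have h4 : (p - 1) % p = p - 1 := Nat.mod_eq_of_lt (by omega)
    rw [h2, h3, h4] at h1
    simpa using h1

theorem nat_card_filter {α : Type*} [Fintype α] (P : α → Prop) [DecidablePred P] :
    Nat.card {a // P a} = (Finset.univ.filter P).card := by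
  rw [Nat.card_eq_fintype_card, Fintype.card_subtype]

theorem main_count (G : Type*) [Group G] [Finite G] (p h t : ℕ) (hp : p.Prime)
    (hh : 0 < h) (hG : Nat.card G = h * p * t) :
    Nat.card {H : Subgroup G // Nat.card H = h} * (p * t).choose p =
      Nat.card {X : PS G // X.size = h * p ∧ Nat.card (MulAction.stabilizer G X) = h} +
      t * ∑ K ∈ Finset.univ.filter (fun K : Subgroup G => Nat.card K = h * p),
        Nat.card {H : Subgroup K // Nat.card H = h} := by
  have hhp : 0 < h * p := Nat.mul_pos hh hp.pos
  have hne : h ≠ h * p := by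
    intro e
    have := hp.two_le
    nlinarith
  set SH := Finset.univ.filter (fun H : Subgroup G => Nat.card H = h) with hSH
  set SX := Finset.univ.filter (fun X : PS G => X.size = h * p) with hSX
  have key := Finset.sum_card_bipartiteAbove_eq_sum_card_bipartiteBelow
    (s := SH) (t := SX) (fun H X => H ≤ MulAction.stabilizer G X)
  have left : ∑ H ∈ SH, (SX.bipartiteAbove (fun H X => H ≤ MulAction.stabilizer G X) H).card =
      Nat.card {H : Subgroup G // Nat.card H = h} * (p * t).choose p := by
    rw [nat_card_filter, ← smul_eq_mul, ← Finset.sum_const]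
    refine Finset.sum_congr (by rw [hSH]) ?_
    intro H hH
    have hH' : Nat.card H = h := by simpa [hSH] using hH
    have hi : H.index = p * t := by
      apply Nat.eq_of_mul_eq_mul_left hh
      rw [← hH', Subgroup.card_mul_index, hG, hH', mul_assoc]
    rw [← hi, ← ps_count H p, nat_card_filter, Finset.bipartiteAbove, hSX, Finset.filter_filter,
      hH']
    congr 1
    ext X
    simp [and_comm]
  set f : Subgroup G → ℕ := fun K => Nat.card {H : Subgroup K // Nat.card H = h} with hf
  have right : ∀ X ∈ SX,
      (SH.bipartiteBelow (fun H X => H ≤ MulAction.stabilizer G X) X).card =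
      (if Nat.card (MulAction.stabilizer G X) = h then 1 else 0) +
      ∑ K ∈ Finset.univ.filter (fun K : Subgroup G => Nat.card K = h * p),
        if MulAction.stabilizer G X = K then f K else 0 := by
    intro X hX
    have hX' : X.size = h * p := by simpa [hSX] using hX
    have hd := ps_stab_dvd X
    rw [hX'] at hd
    have e : (SH.bipartiteBelow (fun H X => H ≤ MulAction.stabilizer G X) X).card =
        f (MulAction.stabilizer G X) := by
      rw [hf]
      simp only
      rw [card_subgroups_le, nat_card_filter, Finset.bipartiteBelow, hSH, Finset.filter_filter]
      try congr!
    rw [e, Finset.sum_ite_eq]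
    set S := MulAction.stabilizer G X with hS
    simp only [Finset.mem_filter, Finset.mem_univ, true_and]
    by_cases h1 : Nat.card S = h
    · rw [if_pos h1, if_neg (by rw [h1]; exact hne), add_zero, hf]
      simp only
      rw [card_subgroups_le, Nat.card_eq_one_iff_unique]
      refine ⟨⟨?_⟩, ⟨⟨S, h1, le_rfl⟩⟩⟩
      rintro ⟨H, hH, hHS⟩ ⟨H', hH', hHS'⟩
      apply Subtype.ext
      simp only
      rw [Subgroup.eq_of_le_of_card_ge hHS (by rw [hH, h1]),
        Subgroup.eq_of_le_of_card_ge hHS' (by rw [hH', h1])]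
    · rw [if_neg h1, zero_add]
      by_cases h2 : Nat.card S = h * p
      · rw [if_pos h2]
      · rw [if_neg h2, hf]
        simp only
        rw [card_subgroups_le, Nat.card_eq_zero]
        left
        constructor
        rintro ⟨H, hH, hHS⟩
        obtain ⟨d, hd'⟩ := Subgroup.card_dvd_of_le hHS
        rw [hH] at hd'
        rw [hd'] at hd
        have hdp := Nat.dvd_of_mul_dvd_mul_left hh hd
        rcases (Nat.dvd_prime hp).mp hdp with rfl | rfl
        · exact h1 (by rw [hd', mul_one])
        · exact h2 hd'
  rw [← left, key, Finset.sum_congr rfl right, Finset.sum_add_distrib]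
  congr 1
  · rw [← Finset.card_filter, hSX, Finset.filter_filter, nat_card_filter]
    try congr!
  · rw [Finset.sum_comm, Finset.mul_sum]
    apply Finset.sum_congr rfl
    intro K hK
    have hK' : Nat.card K = h * p := by simpa using hK
    rw [← Finset.sum_filter, Finset.sum_const, smul_eq_mul]
    congr 1
    have hi : K.index = t := by
      apply Nat.eq_of_mul_eq_mul_left hhp
      rw [← hK', Subgroup.card_mul_index, hG, hK']
    have hc := ps_count K 1
    rw [Nat.choose_one_right, hi, nat_card_filter] at hc
    rw [← hc, hSX, Finset.filter_filter]
    congr 1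
    ext X
    simp only [Finset.mem_filter, Finset.mem_univ, true_and, hK', mul_one]
    constructor
    · rintro ⟨h1, h2⟩
      exact ⟨h2.ge, h1⟩
    · rintro ⟨h1, h2⟩
      refine ⟨h2, (Subgroup.eq_of_le_of_card_ge h1 ?_).symm⟩
      rw [hK']
      have := ps_stab_dvd X
      rw [h2] at this
      exact Nat.le_of_dvd hhp this

/-- For a prime `p` and `h` with `hp ∣ |G|`:
`ψ_G(h) ≡ ∑_{K ≤ G, |K| = hp} ψ_K(h) (mod p)`, where `ψ_K(n)` counts the subgroups of
order `n` of `K`. -/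
theorem stmt10 (G : Type*) [Group G] [Fintype G] (p h : ℕ) (hp : p.Prime)
    (hh : 0 < h) (hdvd : h * p ∣ Nat.card G) :
    Nat.card {H : Subgroup G // Nat.card H = h} ≡
      ∑ K ∈ Finset.univ.filter (fun K : Subgroup G => Nat.card K = h * p),
        Nat.card {H : Subgroup K // Nat.card H = h} [MOD p] := by
  obtain ⟨t, ht⟩ := hdvd
  have hG : 0 < Nat.card G := Nat.card_pos
  have ht0 : 0 < t := Nat.pos_of_ne_zero (by rintro rfl; simp at ht)
  have key := main_count G p h t hp hh ht
  obtain ⟨a, ha⟩ := ps_dvd (G := G) h (p * t) (h * p) hh (by rw [ht, mul_assoc])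
  obtain ⟨c, hc, hc1⟩ := choose_aux p t hp ht0
  rw [ha, hc] at key
  set S := ∑ K ∈ Finset.univ.filter (fun K : Subgroup G => Nat.card K = h * p),
        Nat.card {H : Subgroup K // Nat.card H = h}
  have key2 : Nat.card {H : Subgroup G // Nat.card H = h} * c = p * a + S := by
    apply Nat.eq_of_mul_eq_mul_left ht0
    linarith
  have h1 := (Nat.ModEq.refl (n := p) (Nat.card {H : Subgroup G // Nat.card H = h})).mul hc1
  rw [key2, mul_one] at h1
  refine h1.symm.trans ?_
  simp [Nat.ModEq]
end

section
/- Let G be a finite group and t a divisor of |G|. Then the number of elements g ∈ G whose order divides t is congruent to 0 modulo t (Frobenius' theorem), and this follows from: for all t ∣ |G|, Σ_{d∣t} χ_G(d)·C((t/d)·(|G|/t) − 1, (t/d) − 1) ≡ 0 mod t, combined with the binomial equivalence criterion. -/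
open scoped Classical

open scoped Pointwise

namespace FrobAux

/-- Pull back a set of left cosets to an invariant finset, through inversion. -/
noncomputable def pull {G : Type*} [Group G] [Fintype G] (g : G)
    (T : Finset (G ⧸ Subgroup.zpowers g)) : Finset G :=
  Finset.univ.filter fun x => (QuotientGroup.mk x⁻¹ : G ⧸ Subgroup.zpowers g) ∈ T

theorem mem_pull {G : Type*} [Group G] [Fintype G] (g : G)
    (T : Finset (G ⧸ Subgroup.zpowers g)) (x : G) :
    x ∈ pull g T ↔ (QuotientGroup.mk x⁻¹ : G ⧸ Subgroup.zpowers g) ∈ T := by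
  simp [pull]

theorem card_pull {G : Type*} [Group G] [Fintype G] (g : G)
    (T : Finset (G ⧸ Subgroup.zpowers g)) :
    (pull g T).card = orderOf g * T.card := by
  have h := QuotientGroup.card_preimage_mk (Subgroup.zpowers g) (T : Set (G ⧸ Subgroup.zpowers g))
  rw [Nat.card_zpowers, Nat.card_coe_set_eq, Nat.card_coe_set_eq, Set.ncard_coe_finset] at h
  rw [← h, ← Set.ncard_coe_finset]
  rw [← Set.ncard_image_of_injective _ (inv_injective (G := G))]
  congr 1
  ext x
  simp only [Set.mem_image, Finset.mem_coe, mem_pull, Set.mem_preimage]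
  constructor
  · rintro ⟨y, hy, rfl⟩
    exact hy
  · intro hx
    exact ⟨x⁻¹, by simpa using hx, by simp⟩

theorem pull_injective {G : Type*} [Group G] [Fintype G] (g : G) :
    Function.Injective (pull g) := by
  intro T U h
  ext q
  obtain ⟨x, rfl⟩ := QuotientGroup.mk_surjective q
  have := mem_pull g T x⁻¹
  have h2 := mem_pull g U x⁻¹
  rw [inv_inv] at this h2
  rw [← this, ← h2, h]

theorem smul_pull {G : Type*} [Group G] [Fintype G] (g : G)
    (T : Finset (G ⧸ Subgroup.zpowers g)) : g • pull g T = pull g T := by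
  ext x
  rw [← Finset.inv_smul_mem_iff, mem_pull, mem_pull]
  have : (QuotientGroup.mk (g⁻¹ • x)⁻¹ : G ⧸ Subgroup.zpowers g) = QuotientGroup.mk x⁻¹ := by
    rw [QuotientGroup.eq]
    simp
  rw [this]

theorem exists_pull {G : Type*} [Group G] [Fintype G] (g : G) (S : Finset G)
    (hS : g • S = S) : ∃ T, pull g T = S := by
  refine ⟨S.image fun x => QuotientGroup.mk x⁻¹, ?_⟩
  ext x
  rw [mem_pull, Finset.mem_image]
  constructor
  · rintro ⟨y, hy, hxy⟩
    rw [QuotientGroup.eq, inv_inv] at hxy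
    have hle : Subgroup.zpowers g ≤ MulAction.stabilizer G S := by
      rw [Subgroup.zpowers_le]
      exact hS
    have h := hle (inv_mem hxy)
    rw [MulAction.mem_stabilizer_iff] at h
    rw [← h, ← Finset.inv_smul_mem_iff]
    simpa using hy
  · intro hx
    exact ⟨x, hx, rfl⟩

theorem card_fixed {G : Type*} [Group G] [Fintype G] (g : G) (t : ℕ) :
    (Finset.univ.filter fun S : Finset G => S.card = t ∧ g • S = S).card =
      if orderOf g ∣ t then (Nat.card G / orderOf g).choose (t / orderOf g) else 0 := by
  have hpos : 0 < orderOf g := orderOf_pos g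
  split_ifs with hd
  · have : (Finset.univ.filter fun S : Finset G => S.card = t ∧ g • S = S) =
        (Finset.powersetCard (t / orderOf g)
          (Finset.univ : Finset (G ⧸ Subgroup.zpowers g))).image (pull g) := by
      ext S
      simp only [Finset.mem_filter, Finset.mem_univ, true_and, Finset.mem_image,
        Finset.mem_powersetCard, Finset.subset_univ]
      constructor
      · rintro ⟨hc, hS⟩
        obtain ⟨T, rfl⟩ := exists_pull g S hS
        refine ⟨T, ?_, rfl⟩
        rw [card_pull] at hc
        rw [← hc, Nat.mul_div_cancel_left _ hpos]
      · rintro ⟨T, hT, rfl⟩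
        exact ⟨by rw [card_pull, hT, Nat.mul_div_cancel' hd], smul_pull g T⟩
    rw [this, Finset.card_image_of_injective _ (pull_injective g), Finset.card_powersetCard,
      Finset.card_univ, ← Nat.card_eq_fintype_card]
    congr 1
    have h := Subgroup.card_eq_card_quotient_mul_card_subgroup (Subgroup.zpowers g)
    rw [Nat.card_zpowers] at h
    rw [h, Nat.mul_div_cancel _ hpos]
  · rw [Finset.card_eq_zero, Finset.filter_eq_empty_iff]
    rintro S - ⟨hc, hS⟩
    obtain ⟨T, rfl⟩ := exists_pull g S hS
    exact hd ⟨_, hc.symm.trans (card_pull g T)⟩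

theorem card_fixedBy {G : Type*} [Group G] [Fintype G] (g : G) (t : ℕ) :
    Fintype.card (MulAction.fixedBy (Set.powersetCard G t) g) =
      if orderOf g ∣ t then (Nat.card G / orderOf g).choose (t / orderOf g) else 0 := by
  rw [← card_fixed, ← Fintype.card_subtype]
  refine Fintype.card_congr
    { toFun := fun S => ⟨S.1.1, S.1.2, ?_⟩
      invFun := fun S => ⟨⟨S.1, S.2.1⟩, ?_⟩
      left_inv := fun S => rfl
      right_inv := fun S => rfl }
  · have := S.2
    rw [MulAction.mem_fixedBy] at this
    exact congrArg Subtype.val this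
  · rw [MulAction.mem_fixedBy]
    exact Subtype.ext S.2.2

theorem part_one (G : Type*) [Group G] [Fintype G] (t : ℕ) (ht : t ∣ Nat.card G) :
      t ∣ ∑ d ∈ t.divisors,
        (Finset.univ.filter fun g : G => orderOf g = d).card *
          (t / d * (Nat.card G / t) - 1).choose (t / d - 1) := by
  obtain ⟨m, hm⟩ := ht
  have hn : 0 < Nat.card G := Nat.card_pos
  have ht0 : 0 < t := Nat.pos_of_ne_zero (by rintro rfl; simp at hm)
  have hm0 : 0 < m := Nat.pos_of_ne_zero (by rintro rfl; simp at hm)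
  have hB := MulAction.sum_card_fixedBy_eq_card_orbits_mul_card_group G (Set.powersetCard G t)
  simp only [card_fixedBy] at hB
  rw [← Nat.card_eq_fintype_card (α := G)] at hB
  have hdiv : Nat.card G / t = m := by rw [hm, Nat.mul_div_cancel_left _ ht0]
  rw [hdiv]
  refine ⟨Fintype.card (Quotient (MulAction.orbitRel G (Set.powersetCard G t))),
    Nat.eq_of_mul_eq_mul_left hm0 (Eq.trans ?_ (hB.trans (by rw [hm]; ring)))⟩
  rw [← Finset.sum_filter, Finset.mul_sum]
  rw [← Finset.sum_fiberwise_of_maps_to (t := t.divisors) (g := fun g : G => orderOf g)]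
  · refine Finset.sum_congr rfl fun d hd => ?_
    have hdt := Nat.dvd_of_mem_divisors hd
    rw [Finset.filter_filter]
    have : (Finset.univ.filter fun g : G => orderOf g ∣ t ∧ orderOf g = d) =
        Finset.univ.filter fun g : G => orderOf g = d := by
      refine Finset.filter_congr fun g _ => ?_
      constructor
      · exact fun h => h.2
      · rintro rfl
        exact ⟨hdt, rfl⟩
    rw [this, Finset.sum_congr rfl (g := fun _ => (Nat.card G / d).choose (t / d)),
      Finset.sum_const, smul_eq_mul, mul_left_comm]
    · congr 1
      obtain ⟨s, rfl⟩ := hdt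
      have hd0 : 0 < d := Nat.pos_of_ne_zero (by rintro rfl; simp at ht0)
      have hs0 : 0 < s := Nat.pos_of_ne_zero (by rintro rfl; simp at ht0)
      rw [hm, mul_assoc, Nat.mul_div_cancel_left _ hd0, Nat.mul_div_cancel_left _ hd0]
      have hsm : 0 < s * m := Nat.mul_pos hs0 hm0
      have := Nat.add_one_mul_choose_eq (s * m - 1) (s - 1)
      rw [Nat.sub_add_cancel hsm, Nat.sub_add_cancel hs0] at this
      refine Nat.eq_of_mul_eq_mul_left hs0 ?_
      rw [← mul_assoc, this, mul_comm]
    · intro g hg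
      rw [(Finset.mem_filter.1 hg).2]
  · intro g hg
    exact Nat.mem_divisors.2 ⟨(Finset.mem_filter.1 hg).2, ht0.ne'⟩

/-- `s ↦ C(s m - 1, s - 1)` as an arithmetic function. -/
noncomputable def binom (m : ℕ) : ArithmeticFunction ℤ :=
  ⟨fun s => if s = 0 then 0 else ((s * m - 1).choose (s - 1) : ℤ), by simp⟩

/-- Euler's totient as an arithmetic function. -/
noncomputable def phi : ArithmeticFunction ℤ :=
  ⟨fun s => (Nat.totient s : ℤ), by simp⟩

/-- The number of elements of a given order, as an arithmetic function. -/
noncomputable def chi (G : Type*) [Group G] [Fintype G] : ArithmeticFunction ℤ :=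
  ⟨fun d => if d = 0 then 0 else ((Finset.univ.filter fun g : G => orderOf g = d).card : ℤ), by simp⟩

theorem mul_binom (f : ArithmeticFunction ℤ) (m t : ℕ) :
    (f * binom m) t =
      ∑ d ∈ t.divisors, f d * ((t / d * m - 1).choose (t / d - 1) : ℤ) := by
  rw [ArithmeticFunction.mul_apply,
    Nat.sum_divisorsAntidiagonal (fun a b => f a * binom m b)]
  refine Finset.sum_congr rfl fun d hd => ?_
  have hdt := Nat.dvd_of_mem_divisors hd
  have ht : t ≠ 0 := (Nat.mem_divisors.1 hd).2
  have : t / d ≠ 0 := (Nat.div_pos (Nat.le_of_dvd (Nat.pos_of_ne_zero ht) hdt)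
    (Nat.pos_of_mem_divisors hd)).ne'
  simp [binom, this]

theorem chi_binom (G : Type*) [Group G] [Fintype G] (t : ℕ) (ht : t ∣ Nat.card G) :
    (t : ℤ) ∣ (chi G * binom (Nat.card G / t)) t := by
  have h := part_one G t ht
  rw [mul_binom]
  rw [← Int.natCast_dvd_natCast] at h
  push_cast at h
  convert h using 2 with d hd
  have : d ≠ 0 := (Nat.pos_of_mem_divisors hd).ne'
  simp [chi, this]

/-- Gauss congruence for the binomial sequence, from the cyclic group of order `s * m`. -/
theorem phi_binom (s m : ℕ) (hs : 0 < s) (hm : 0 < m) :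
    (s : ℤ) ∣ (phi * binom m) s := by
  have : NeZero (s * m) := ⟨(Nat.mul_pos hs hm).ne'⟩
  have hc : Nat.card (Multiplicative (ZMod (s * m))) = s * m := by simp
  have h := chi_binom (Multiplicative (ZMod (s * m))) s (by rw [hc]; exact ⟨m, rfl⟩)
  rw [hc, Nat.mul_div_cancel_left _ hs, mul_binom] at h
  rw [mul_binom]
  convert h using 2 with d hd
  have hd0 : d ≠ 0 := (Nat.pos_of_mem_divisors hd).ne'
  have hdc : d ∣ Fintype.card (Multiplicative (ZMod (s * m))) := by
    rw [← Nat.card_eq_fintype_card, hc]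
    exact (Nat.dvd_of_mem_divisors hd).mul_right m
  have := IsCyclic.card_orderOf_eq_totient hdc
  simp [chi, phi, hd0, ← this]

theorem phi_zeta (s : ℕ) : (phi * (ArithmeticFunction.zeta : ArithmeticFunction ℤ)) s = s := by
  rw [ArithmeticFunction.coe_mul_zeta_apply]
  simp only [phi, ArithmeticFunction.coe_mk]
  exact_mod_cast Nat.sum_totient s

theorem part_two (G : Type*) [Group G] [Fintype G] (t : ℕ) (ht : t ∣ Nat.card G) :
    t ∣ (Finset.univ.filter fun g : G => g ^ t = 1).card := by
  have hn : 0 < Nat.card G := Nat.card_pos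
  have hu : IsUnit phi := by
    rw [ArithmeticFunction.isUnit_iff_isUnit_apply_one]
    simp [phi]
  obtain ⟨u, hu⟩ := hu
  obtain ⟨a, ha⟩ : ∃ a : ArithmeticFunction ℤ, chi G = a * phi :=
    ⟨chi G * ((u⁻¹ : (ArithmeticFunction ℤ)ˣ) : ArithmeticFunction ℤ), by
      rw [← hu, mul_assoc, Units.inv_mul, mul_one]⟩
  have key : ∀ e : ℕ, e ∣ Nat.card G → (e : ℤ) ∣ a e := by
    intro e
    induction e using Nat.strong_induction_on with
    | _ e ih =>
      intro he
      have he0 : 0 < e := Nat.pos_of_dvd_of_pos he hn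
      have h := chi_binom G e he
      have hm : 0 < Nat.card G / e := Nat.div_pos (Nat.le_of_dvd hn he) he0
      rw [ha, mul_assoc, ArithmeticFunction.mul_apply] at h
      have hmem : (e, 1) ∈ e.divisorsAntidiagonal := by simp [he0.ne']
      rw [← Finset.add_sum_erase _ _ hmem] at h
      have h1 : (phi * binom (Nat.card G / e)) 1 = 1 := by
        rw [mul_binom]
        simp [phi]
      rw [h1, mul_one] at h
      refine (Int.dvd_add_left (Finset.dvd_sum fun p hp => ?_)).1 h
      obtain ⟨hne, hp⟩ := Finset.mem_erase.1 hp
      obtain ⟨hpe, -⟩ := Nat.mem_divisorsAntidiagonal.1 hp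
      obtain ⟨x, y⟩ := p
      dsimp only at hpe ⊢
      subst hpe
      have hy0 : 0 < y := Nat.pos_of_ne_zero (by rintro rfl; simp at he0)
      have hx0 : 0 < x := Nat.pos_of_ne_zero (by rintro rfl; simp at he0)
      have hy1 : y ≠ 1 := by
        rintro rfl
        simp at hne
      rw [Nat.cast_mul]
      refine mul_dvd_mul (ih x ?_ ((Dvd.intro _ rfl).trans he)) (phi_binom _ _ hy0 hm)
      have : 2 ≤ y := by omega
      nlinarith
  have ht0 : 0 < t := Nat.pos_of_dvd_of_pos ht hn
  have hsum : (((Finset.univ.filter fun g : G => g ^ t = 1).card : ℕ) : ℤ) =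
      (chi G * (ArithmeticFunction.zeta : ArithmeticFunction ℤ)) t := by
    have hcount : ∑ d ∈ t.divisors, (Finset.univ.filter fun g : G => orderOf g = d).card =
        (Finset.univ.filter fun g : G => g ^ t = 1).card := by
      convert sum_card_orderOf_eq_card_pow_eq_one (G := G) ht0.ne'
    rw [ArithmeticFunction.coe_mul_zeta_apply, ← hcount, Nat.cast_sum]
    refine Finset.sum_congr rfl fun d hd => ?_
    have hd0 : d ≠ 0 := by
      rintro rfl
      simp at hd
    simp [chi, hd0]
  rw [← Int.natCast_dvd_natCast, hsum, ha, mul_assoc, ArithmeticFunction.mul_apply]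
  refine Finset.dvd_sum fun p hp => ?_
  obtain ⟨hpe, -⟩ := Nat.mem_divisorsAntidiagonal.1 hp
  rw [phi_zeta, ← hpe, Nat.cast_mul]
  exact mul_dvd_mul_right (key _ ((Dvd.intro _ hpe).trans ht)) _

end FrobAux


/-- Frobenius' theorem: `t ∣ |{g : g^t = 1}|` for every `t ∣ |G|`; it follows from the
congruences `∑_{d ∣ t} χ_G(d) * C((t/d)(|G|/t) - 1, t/d - 1) ≡ 0 (mod t)` combined with
the binomial equivalence criterion. -/
theorem stmt12 (G : Type*) [Group G] [Fintype G] :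
    (∀ t : ℕ, t ∣ Nat.card G →
      t ∣ ∑ d ∈ t.divisors,
        (Finset.univ.filter fun g : G => orderOf g = d).card *
          (t / d * (Nat.card G / t) - 1).choose (t / d - 1)) ∧
    (∀ t : ℕ, t ∣ Nat.card G →
      t ∣ (Finset.univ.filter fun g : G => g ^ t = 1).card) := by
  exact ⟨fun t ht => FrobAux.part_one G t ht, fun t ht => FrobAux.part_two G t ht⟩
end

section
/- Let G be a finite group, F ≤ G a subgroup, C the conjugacy class of F in G, and n a divisor of |G|. Then n divides Σ_{H ∈ C} |{g ∈ G : |⟨H ∪ {g}⟩| divides n}|; equivalently, n divides |C| times the number of elements g ∈ G such that the order of the subgroup generated by F and g divides n. -/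
open scoped Classical

open scoped Pointwise

/-- Weighted orbit counting: `|G|` divides `∑ x, |Stab x| * c x` for invariant `c`. -/
theorem aux_orbit {G Ω : Type*} [Group G] [Finite G] [Fintype Ω] [MulAction G Ω]
    (c : Ω → ℕ) (hc : ∀ (g : G) x, c (g • x) = c x) :
    Nat.card G ∣ ∑ x, Nat.card (MulAction.stabilizer G x) * c x := by
  rw [← Finset.sum_fiberwise (s := Finset.univ)
    (g := fun x : Ω => (Quotient.mk'' x : MulAction.orbitRel.Quotient G Ω))]
  refine Finset.dvd_sum fun q _ => ?_
  induction q using Quotient.inductionOn' with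
  | h x =>
    have hmem : ∀ y : Ω, (Quotient.mk'' y : MulAction.orbitRel.Quotient G Ω) = Quotient.mk'' x ↔
        y ∈ MulAction.orbit G x := fun y => by
      rw [Quotient.eq'']; exact MulAction.orbitRel_apply
    have hconst : ∀ y ∈ Finset.univ.filter (fun y : Ω =>
        (Quotient.mk'' y : MulAction.orbitRel.Quotient G Ω) = Quotient.mk'' x),
        Nat.card (MulAction.stabilizer G y) * c y = Nat.card (MulAction.stabilizer G x) * c x := by
      intro y hy
      obtain ⟨g, rfl⟩ := (hmem y).1 (Finset.mem_filter.1 hy).2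
      change Nat.card (MulAction.stabilizer G (g • x)) * c (g • x) = _
      rw [hc, MulAction.stabilizer_smul_eq_stabilizer_map_conj]
      congr 1
      exact Subgroup.card_map_of_injective (MulAut.conj g).injective
    rw [Finset.sum_congr rfl hconst, Finset.sum_const, smul_eq_mul, ← mul_assoc]
    refine Dvd.dvd.mul_right (dvd_of_eq ?_) _
    have := Fintype.ofFinite G
    have h := MulAction.card_orbit_mul_card_stabilizer_eq_card_group G x
    rw [← Nat.card_eq_fintype_card, ← Nat.card_eq_fintype_card, ← Nat.card_eq_fintype_card] at h
    rw [← h]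
    congr 1
    rw [Nat.card_eq_fintype_card, ← Set.toFinset_card]
    congr 1
    ext y
    simp only [Set.mem_toFinset, Finset.mem_filter, Finset.mem_univ, true_and]
    exact (hmem y).symm

/-- The number of `n`-subsets fixed by a subgroup of order `u` in a group of order `m`. -/
noncomputable def auxF (m n u : ℕ) : ℕ :=
  (Finset.univ.filter fun Y : Finset (Fin (m / u)) => u * Y.card = n).card

theorem aux_count {G : Type*} [Group G] [Fintype G] (n : ℕ) (U : Subgroup G) :
    (Finset.univ.filter fun X : Finset G => X.card = n ∧ U ≤ MulAction.stabilizer G X).card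
      = auxF (Nat.card G) n (Nat.card U) := by
  have hQ : Nat.card (G ⧸ U) = Nat.card G / Nat.card U := by
    rw [Subgroup.card_eq_card_quotient_mul_card_subgroup U, Nat.mul_div_cancel _ Nat.card_pos]
  let e : (G ⧸ U) ≃ Fin (Nat.card G / Nat.card U) := Finite.equivFinOfCardEq hQ
  let p : G → Fin (Nat.card G / Nat.card U) := fun x => e (QuotientGroup.mk x⁻¹)
  have hp : ∀ x y, p x = p y ↔ x * y⁻¹ ∈ U := by
    intro x y
    simp [p, QuotientGroup.eq]
  have hsurj : Function.Surjective p := by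
    intro i
    obtain ⟨x, hx⟩ := QuotientGroup.mk_surjective (e.symm i)
    exact ⟨x⁻¹, by simp [p, hx]⟩
  have hcard : ∀ Y : Finset (Fin (Nat.card G / Nat.card U)),
      (Finset.univ.filter fun x => p x ∈ Y).card = Nat.card U * Y.card := by
    intro Y
    have h := Nat.card_congr (QuotientGroup.preimageMkEquivSubgroupProdSet U (e ⁻¹' (Y : Set _)))
    rw [Nat.card_prod] at h
    have h2 : Nat.card (e ⁻¹' (Y : Set _)) = Y.card := by
      rw [Nat.card_preimage_of_injective e.injective (by simp)]; simp
    rw [h2] at h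
    refine Eq.trans ?_ h
    refine Eq.trans ?_ (Nat.card_eq_fintype_card).symm
    rw [← Set.toFinset_card]
    refine Finset.card_bij (fun x _ => x⁻¹) ?_ ?_ ?_
    · intro x hx; simpa [p] using hx
    · intro x _ y _ h; simpa using h
    · intro y hy; exact ⟨y⁻¹, by simpa [p] using hy, by simp⟩
  symm
  unfold auxF
  refine Finset.card_bij (fun Y _ => Finset.univ.filter fun x => p x ∈ Y) ?_ ?_ ?_
  · intro Y hY
    simp only [Finset.mem_filter, Finset.mem_univ, true_and] at hY ⊢
    refine ⟨by rw [hcard, hY], fun u hu => ?_⟩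
    rw [MulAction.mem_stabilizer_iff]
    ext x
    rw [← Finset.inv_smul_mem_iff]
    have : p (u⁻¹ • x) = p x := by rw [hp]; simpa using hu
    rw [Finset.mem_filter, Finset.mem_filter, this]
    simp
  · intro Y _ Z _ h
    ext i
    obtain ⟨x, rfl⟩ := hsurj i
    have := congrArg (fun S => x ∈ S) h
    simpa using this
  · intro X hX
    simp only [Finset.mem_filter, Finset.mem_univ, true_and] at hX
    have hX2 : (Finset.univ.filter fun x => p x ∈ X.image p) = X := by
      ext x
      simp only [Finset.mem_filter, Finset.mem_univ, true_and, Finset.mem_image]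
      constructor
      · rintro ⟨y, hy, hyx⟩
        have h1 := hX.2 ((hp x y).1 hyx.symm)
        rw [MulAction.mem_stabilizer_iff] at h1
        rw [← h1, ← Finset.inv_smul_mem_iff]
        simpa using hy
      · intro hx; exact ⟨x, hx, rfl⟩
    refine ⟨X.image p, ?_, hX2⟩
    simp only [Finset.mem_filter, Finset.mem_univ, true_and]
    rw [← hcard, hX2, hX.1]

/-- Arithmetic input, obtained from the cyclic group of order `m`. -/
theorem aux_cyclic' (C : Type) [CommGroup C] [IsCyclic C] [Fintype C]
    (m n : ℕ) (hC : Nat.card C = m) (hm : 0 < m) (hn : n ∣ m) :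
    ∃ b : ℕ → ℕ, (∀ d, m ∣ d * b d) ∧ b n = m / n ∧
      ∀ u, u ∣ m → auxF m n u = ∑ d ∈ n.divisors, if u ∣ d then b d else 0 := by
  have hn0 : 0 < n := Nat.pos_of_dvd_of_pos hn hm
  let b : ℕ → ℕ := fun d => (Finset.univ.filter fun X : Finset C =>
    X.card = n ∧ Nat.card (MulAction.stabilizer C X) = d).card
  let K : ℕ → Subgroup C := fun u => (powMonoidHom u : C →* C).ker
  have hK : ∀ u, u ∣ m → Nat.card (K u) = u := by
    intro u hu
    rw [IsCyclic.card_powMonoidHom_ker, hC, Nat.gcd_eq_right hu]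
  have hKS : ∀ S : Subgroup C, S = K (Nat.card S) := by
    intro S
    apply Subgroup.eq_of_le_of_card_ge
    · intro x hx
      rw [MonoidHom.mem_ker, powMonoidHom_apply]
      have h := pow_card_eq_one' (x := (⟨x, hx⟩ : S))
      exact congrArg Subtype.val h
    · rw [hK _ (hC ▸ Subgroup.card_subgroup_dvd_card S)]
  have hle : ∀ u, u ∣ m → ∀ S : Subgroup C, K u ≤ S ↔ u ∣ Nat.card S := by
    intro u hu S
    constructor
    · intro h
      have := Subgroup.card_dvd_of_le h
      rwa [hK u hu] at this
    · rintro ⟨k, hk⟩ x hx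
      rw [hKS S, hk]
      rw [MonoidHom.mem_ker, powMonoidHom_apply] at hx ⊢
      rw [pow_mul, hx, one_pow]
  have hdn : ∀ X : Finset C, X.card = n → Nat.card (MulAction.stabilizer C X) ∣ n := by
    intro X hX
    have h := aux_count n (MulAction.stabilizer C X)
    have h1 : 0 < auxF (Nat.card C) n (Nat.card (MulAction.stabilizer C X)) := by
      rw [← h]
      exact Finset.card_pos.2 ⟨X, by simp [hX]⟩
    obtain ⟨Y, hY⟩ := Finset.card_pos.1 h1
    exact ⟨_, (Finset.mem_filter.1 hY).2.symm⟩
  have hsum : ∀ u, u ∣ m → auxF m n u = ∑ d ∈ n.divisors, if u ∣ d then b d else 0 := by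
    intro u hu
    have h := aux_count n (K u)
    rw [hK u hu, hC] at h
    rw [← h]
    rw [Finset.card_eq_sum_card_fiberwise (f := fun X : Finset C =>
      Nat.card (MulAction.stabilizer C X)) (t := n.divisors)]
    · refine Finset.sum_congr rfl fun d _ => ?_
      rw [Finset.filter_filter]
      split_ifs with hd
      · congr 1
        ext X
        simp only [Finset.mem_filter, Finset.mem_univ, true_and, hle u hu]
        constructor
        · rintro ⟨⟨h1, _⟩, h3⟩; exact ⟨h1, h3⟩
        · rintro ⟨h1, h3⟩; exact ⟨⟨h1, h3 ▸ hd⟩, h3⟩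
      · rw [Finset.card_eq_zero, Finset.filter_eq_empty_iff]
        rintro X _ ⟨⟨_, h2⟩, h3⟩
        rw [hle u hu, h3] at h2
        exact hd h2
    · intro X hX
      have hX := (Finset.mem_filter.1 hX).2
      exact Nat.mem_divisors.2 ⟨hdn X hX.1, hn0.ne'⟩
  refine ⟨b, ?_, ?_, hsum⟩
  · intro d
    have h := aux_orbit (G := C) (Ω := Finset C)
      (fun X => if X.card = n ∧ Nat.card (MulAction.stabilizer C X) = d then 1 else 0) ?_
    · rw [hC] at h
      convert h using 1
      simp only [b, Finset.card_filter, Finset.mul_sum]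
      refine Finset.sum_congr rfl fun X _ => ?_
      split_ifs with hX
      · rw [hX.2]
      · simp
    · intro g X
      have h1 : Nat.card (MulAction.stabilizer C (g • X)) = Nat.card (MulAction.stabilizer C X) := by
        rw [MulAction.stabilizer_smul_eq_stabilizer_map_conj]
        exact Subgroup.card_map_of_injective (MulAut.conj g).injective
      simp only [h1, Finset.card_smul_finset]
  · have h := hsum n hn
    rw [Finset.sum_eq_single n] at h
    · rw [if_pos dvd_rfl] at h
      rw [← h]
      unfold auxF
      have : (Finset.univ.filter fun Y : Finset (Fin (m / n)) => n * Y.card = n)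
          = Finset.powersetCard 1 Finset.univ := by
        ext Y
        simp [Finset.mem_powersetCard, hn0.ne']
      rw [this, Finset.card_powersetCard]
      simp
    · intro d hd hne
      rw [if_neg]
      intro h2
      exact hne (Nat.dvd_antisymm (Nat.dvd_of_mem_divisors hd) h2)
    · intro h; exact absurd (Nat.mem_divisors.2 ⟨dvd_rfl, hn0.ne'⟩) h

theorem aux_cyclic (m n : ℕ) (hm : 0 < m) (hn : n ∣ m) :
    ∃ b : ℕ → ℕ, (∀ d, m ∣ d * b d) ∧ b n = m / n ∧
      ∀ u, u ∣ m → auxF m n u = ∑ d ∈ n.divisors, if u ∣ d then b d else 0 := by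
  have : NeZero m := ⟨hm.ne'⟩
  exact aux_cyclic' (Multiplicative (ZMod m)) m n (Nat.card_zmod m) hm hn

/-- Counting fixed `n`-subsets over all pairs gives a multiple of `|G|`. -/
theorem aux_total {G : Type*} [Group G] [Fintype G] (n : ℕ) (D : Finset (Subgroup G))
    (hD : ∀ (g : G) H, H ∈ D → H.map (MulAut.conj g).toMonoidHom ∈ D) :
    Nat.card G ∣ ∑ H ∈ D, ∑ g : G,
      auxF (Nat.card G) n (Nat.card (H ⊔ Subgroup.closure {g} : Subgroup G)) := by
  have key := aux_orbit (G := G) (Ω := Finset G)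
    (fun X => (D.filter fun H => X.card = n ∧ H ≤ MulAction.stabilizer G X).card) ?_
  · convert key using 1
    simp only [← aux_count, Finset.card_filter, Finset.mul_sum]
    have : ∀ H ∈ D, (∑ g : G, ∑ X : Finset G, if X.card = n ∧
        H ⊔ Subgroup.closure {g} ≤ MulAction.stabilizer G X then 1 else 0) =
        ∑ X : Finset G, Nat.card (MulAction.stabilizer G X) *
          (if X.card = n ∧ H ≤ MulAction.stabilizer G X then 1 else 0) := by
      intro H _
      rw [Finset.sum_comm]
      refine Finset.sum_congr rfl fun X _ => ?_
      simp only [sup_le_iff, Subgroup.closure_le, Set.singleton_subset_iff, SetLike.mem_coe]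
      split_ifs with hX
      · simp only [hX.1, hX.2, true_and, mul_one]
        rw [← Finset.card_filter, Nat.card_eq_fintype_card, Fintype.card_subtype]
      · rw [mul_zero]
        refine Finset.sum_eq_zero fun g _ => if_neg ?_
        tauto
    rw [Finset.sum_congr rfl this, Finset.sum_comm]
  · have hle : ∀ (g : G) (X : Finset G),
        (D.filter fun H => X.card = n ∧ H ≤ MulAction.stabilizer G X).card ≤
        (D.filter fun H => (g • X).card = n ∧ H ≤ MulAction.stabilizer G (g • X)).card := by
      intro g X
      refine Finset.card_le_card_of_injOn
        (fun H => H.map (MulAut.conj g).toMonoidHom) ?_ ?_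
      · intro H hH
        have hH := Finset.mem_filter.1 hH
        refine Finset.mem_filter.2 ⟨hD g H hH.1, ?_, ?_⟩
        · rw [Finset.card_smul_finset]; exact hH.2.1
        · rw [MulAction.stabilizer_smul_eq_stabilizer_map_conj]
          exact Subgroup.map_mono hH.2.2
      · intro H _ K _ h
        exact Subgroup.map_injective (MulAut.conj g).injective h
    intro g X
    refine le_antisymm ?_ (hle g X)
    have := hle g⁻¹ (g • X)
    rwa [inv_smul_smul] at this

theorem aux_main {G : Type*} [Group G] [Fintype G] (D : Finset (Subgroup G))
    (hD : ∀ (g : G) H, H ∈ D → H.map (MulAut.conj g).toMonoidHom ∈ D) (n : ℕ) :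
    n ∣ Nat.card G → n ∣ ∑ H ∈ D, (Finset.univ.filter fun g : G =>
          Nat.card (H ⊔ Subgroup.closure {g} : Subgroup G) ∣ n).card := by
  induction n using Nat.strong_induction_on with
  | _ n ih =>
    intro hn
    have hm : 0 < Nat.card G := Nat.card_pos
    have hn0 : 0 < n := Nat.pos_of_dvd_of_pos hn hm
    obtain ⟨b, hb1, hb2, hb3⟩ := aux_cyclic (Nat.card G) n hm hn
    have htot := aux_total n D hD
    have hrew : ∑ H ∈ D, ∑ g : G,
        auxF (Nat.card G) n (Nat.card (H ⊔ Subgroup.closure {g} : Subgroup G)) =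
        ∑ d ∈ n.divisors, b d * ∑ H ∈ D, (Finset.univ.filter fun g : G =>
          Nat.card (H ⊔ Subgroup.closure {g} : Subgroup G) ∣ d).card := by
      simp only [Finset.card_filter, Finset.mul_sum, mul_ite, mul_one, mul_zero]
      rw [Finset.sum_comm (s := n.divisors)]
      refine Finset.sum_congr rfl fun H _ => ?_
      rw [Finset.sum_comm (s := n.divisors)]
      refine Finset.sum_congr rfl fun g _ => ?_
      exact hb3 _ (Subgroup.card_subgroup_dvd_card _)
    rw [hrew, ← Finset.add_sum_erase _ _ (Nat.mem_divisors.2 ⟨dvd_rfl, hn0.ne'⟩)] at htot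
    have hrest : Nat.card G ∣ ∑ d ∈ n.divisors.erase n, b d *
        ∑ H ∈ D, (Finset.univ.filter fun g : G =>
          Nat.card (H ⊔ Subgroup.closure {g} : Subgroup G) ∣ d).card := by
      refine Finset.dvd_sum fun d hd => ?_
      obtain ⟨hne, hd⟩ := Finset.mem_erase.1 hd
      have hdn := Nat.dvd_of_mem_divisors hd
      obtain ⟨s, hs⟩ := ih d (lt_of_le_of_ne (Nat.le_of_dvd hn0 hdn) hne) (hdn.trans hn)
      rw [hs, ← mul_assoc, mul_comm (b d)]
      exact (hb1 d).mul_right s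
    have h := (Nat.dvd_add_left hrest).1 htot
    rw [hb2] at h
    have hpos : 0 < Nat.card G / n := Nat.div_pos (Nat.le_of_dvd hm hn) hn0
    apply Nat.dvd_of_mul_dvd_mul_left hpos
    rwa [Nat.div_mul_cancel hn]

/-- For a finite group `G`, a subgroup `F` with conjugacy class `C`, and `n ∣ |G|`:
`n` divides `∑_{H ∈ C} |{g ∈ G : |⟨H, g⟩| ∣ n}|`, i.e. `n` divides `|C|` times the
number of `g` with `|⟨F, g⟩| ∣ n`. -/
theorem stmt15 (G : Type*) [Group G] [Fintype G] (F : Subgroup G) (n : ℕ)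
    (hn : n ∣ Nat.card G) :
    n ∣ ∑ H ∈ Finset.univ.filter
          (fun H : Subgroup G => ∃ g : G, H = F.map (MulAut.conj g).toMonoidHom),
        (Finset.univ.filter fun g : G =>
          Nat.card (H ⊔ Subgroup.closure {g} : Subgroup G) ∣ n).card := by
  refine aux_main _ ?_ n hn
  intro g H hH
  obtain ⟨k, rfl⟩ := (Finset.mem_filter.1 hH).2
  refine Finset.mem_filter.2 ⟨Finset.mem_univ _, g * k, ?_⟩
  rw [Subgroup.map_map]
  congr 1
  ext x
  simp [mul_assoc]
end
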